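/- Let R be a commutative noetherian ring, let a and b be ideals of R, and let M be a finitely generated R-module. Then cd(a ∩ b, M) ≤ cd(a, M) + cd(b, M). -/

import Mathlib

open CategoryTheory

/-- The cohomological dimension `cd(a, X) = sup {i | H^i_a(X) ≠ 0}` of an `R`-module `X`
with respect to an ideal `a`. -/
noncomputable def cohDim {R : Type} [CommRing R] (a : Ideal R) (X : ModuleCat R) : ℕ :=
  sSup {i : ℕ | Nontrivial ((localCohomology a i).obj X)}



open Opposite

namespace LC

section basics

variable {R : Type} [CommRing R]

/-- Short-hand for the `Ext` modules of two modules. -/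
abbrev E (N L : ModuleCat.{0} R) (i : ℕ) : Type := Abelian.Ext.{0} N L i

/-- restriction along a map in the first variable -/
noncomputable def pre {N N' L : ModuleCat.{0} R} {i : ℕ} (f : N' ⟶ N) (e : E N L i) : E N' L i :=
  (Abelian.Ext.mk₀ f).comp e (zero_add i)

/-- push-forward along a map in the second variable -/
noncomputable def post {N L L' : ModuleCat.{0} R} {i : ℕ} (e : E N L i) (g : L ⟶ L') : E N L' i :=
  e.comp (Abelian.Ext.mk₀ g) (add_zero i)

lemma pre_comp {N N' N'' L : ModuleCat.{0} R} {i : ℕ} (f : N' ⟶ N) (f' : N'' ⟶ N')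
    (e : E N L i) : pre f' (pre f e) = pre (f' ≫ f) e := by
  simp [pre]

lemma pre_id {N L : ModuleCat.{0} R} {i : ℕ} (e : E N L i) : pre (𝟙 N) e = e := by
  simp [pre]

lemma pre_post {N N' L L' : ModuleCat.{0} R} {i : ℕ} (f : N' ⟶ N) (e : E N L i) (g : L ⟶ L') :
    pre f (post e g) = post (pre f e) g := by
  simp [pre, post]

lemma post_comp {N L L' L'' : ModuleCat.{0} R} {i : ℕ} (e : E N L i) (g : L ⟶ L') (g' : L' ⟶ L'') :
    post (post e g) g' = post e (g ≫ g') := by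
  simp [post]

lemma post_id {N L : ModuleCat.{0} R} {i : ℕ} (e : E N L i) : post e (𝟙 L) = e := by
  simp [post]

@[simp] lemma pre_zero {N N' L : ModuleCat.{0} R} {i : ℕ} (f : N' ⟶ N) :
    pre f (0 : E N L i) = 0 := by simp [pre]

@[simp] lemma post_zero {N L L' : ModuleCat.{0} R} {i : ℕ} (g : L ⟶ L') :
    post (0 : E N L i) g = 0 := by simp [post]

/-- `V N i L`: the colimit of `Ext^i(N_n, L)` vanishes (elementary form). -/
def V (N : ℕᵒᵖ ⥤ ModuleCat.{0} R) (i : ℕ) (L : Type) [AddCommGroup L] [Module R L] : Prop :=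
  ∀ (n : ℕ) (e : E (N.obj (op n)) (ModuleCat.of R L) i), ∃ (m : ℕ) (h : n ≤ m),
    pre (N.map (homOfLE h).op) e = 0

variable {L₁ L₂ L₃ : Type} [AddCommGroup L₁] [Module R L₁] [AddCommGroup L₂] [Module R L₂]
  [AddCommGroup L₃] [Module R L₃]

lemma shortExact (f : L₁ →ₗ[R] L₂) (g : L₂ →ₗ[R] L₃)
    (hf : Function.Injective f) (hg : Function.Surjective g) (h : Function.Exact f g) :
    (ModuleCat.shortComplexOfCompEqZero f g h.linearMap_comp_eq_zero).ShortExact :=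
  ModuleCat.shortComplex_shortExact _ h hf hg

variable {N : ℕᵒᵖ ⥤ ModuleCat.{0} R} {i : ℕ}

lemma V_mid (f : L₁ →ₗ[R] L₂) (g : L₂ →ₗ[R] L₃)
    (hf : Function.Injective f) (hg : Function.Surjective g) (h : Function.Exact f g)
    (h₁ : V N i L₁) (h₃ : V N i L₃) : V N i L₂ := by
  intro n e
  have hS := shortExact f g hf hg h
  obtain ⟨m, hm, h0⟩ := h₃ n (post e (ModuleCat.ofHom g))
  rw [pre_post] at h0
  obtain ⟨x, hx⟩ := Abelian.Ext.covariant_sequence_exact₂ _ hS _ h0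
  obtain ⟨m', hm', h0'⟩ := h₁ m x
  refine ⟨m', hm.trans hm', ?_⟩
  have : N.map (homOfLE (hm.trans hm')).op = N.map (homOfLE hm').op ≫ N.map (homOfLE hm).op := by
    rw [← N.map_comp]; rfl
  rw [this, ← pre_comp, ← hx]
  change pre _ (post x (ModuleCat.ofHom f)) = 0
  rw [pre_post, h0', post_zero]

lemma V_left (f : L₁ →ₗ[R] L₂) (g : L₂ →ₗ[R] L₃)
    (hf : Function.Injective f) (hg : Function.Surjective g) (h : Function.Exact f g)
    (h₃ : V N i L₃) (h₂ : V N (i + 1) L₂) : V N (i + 1) L₁ := by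
  intro n e
  have hS := shortExact f g hf hg h
  obtain ⟨m, hm, h0⟩ := h₂ n (post e (ModuleCat.ofHom f))
  rw [pre_post] at h0
  obtain ⟨x, hx⟩ := Abelian.Ext.covariant_sequence_exact₁ _ hS _ h0 rfl
  obtain ⟨m', hm', h0'⟩ := h₃ m x
  refine ⟨m', hm.trans hm', ?_⟩
  have : N.map (homOfLE (hm.trans hm')).op = N.map (homOfLE hm').op ≫ N.map (homOfLE hm).op := by
    rw [← N.map_comp]; rfl
  rw [this, ← pre_comp, ← hx]
  unfold pre at h0' ⊢
  rw [← Abelian.Ext.comp_assoc _ _ _ (zero_add i) rfl (by lia), h0', Abelian.Ext.zero_comp]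

lemma V_right (f : L₁ →ₗ[R] L₂) (g : L₂ →ₗ[R] L₃)
    (hf : Function.Injective f) (hg : Function.Surjective g) (h : Function.Exact f g)
    (h₂ : V N i L₂) (h₁ : V N (i + 1) L₁) : V N i L₃ := by
  intro n e
  have hS := shortExact f g hf hg h
  obtain ⟨m, hm, h0⟩ := h₁ n (e.comp hS.extClass rfl)
  unfold pre at h0
  rw [← Abelian.Ext.comp_assoc _ _ _ (zero_add i) rfl (by lia)] at h0
  obtain ⟨x, hx⟩ := Abelian.Ext.covariant_sequence_exact₃ _ hS _ _ h0
  obtain ⟨m', hm', h0'⟩ := h₂ m x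
  refine ⟨m', hm.trans hm', ?_⟩
  have : N.map (homOfLE (hm.trans hm')).op = N.map (homOfLE hm').op ≫ N.map (homOfLE hm).op := by
    rw [← N.map_comp]; rfl
  rw [this, ← pre_comp]
  change pre _ ((Abelian.Ext.mk₀ _).comp e _) = 0
  rw [← hx]
  change pre _ (post x (ModuleCat.ofHom g)) = 0
  rw [pre_post, h0', post_zero]

lemma V_left_zero (f : L₁ →ₗ[R] L₂) (hf : Function.Injective f) (h₂ : V N 0 L₂) : V N 0 L₁ := by
  intro n e
  obtain ⟨m, hm, h0⟩ := h₂ n (post e (ModuleCat.ofHom f))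
  rw [pre_post] at h0
  refine ⟨m, hm, ?_⟩
  have : Mono (ModuleCat.ofHom f) := (ModuleCat.mono_iff_injective _).2 hf
  apply Abelian.Ext.postcomp_mk₀_injective_of_mono _ (ModuleCat.ofHom f)
  rw [map_zero]
  exact h0

lemma V_equiv (f : L₁ ≃ₗ[R] L₂) (h : V N i L₁) : V N i L₂ := by
  intro n e
  obtain ⟨m, hm, h0⟩ := h n (post e (ModuleCat.ofHom f.symm.toLinearMap))
  refine ⟨m, hm, ?_⟩
  have : e = post (post e (ModuleCat.ofHom f.symm.toLinearMap)) (ModuleCat.ofHom f.toLinearMap) := by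
    rw [post_comp, ← ModuleCat.ofHom_comp]
    simp only [LinearEquiv.comp_symm]
    exact (post_id e).symm
  rw [this, pre_post, h0, post_zero]

lemma V_subsingleton [Subsingleton L₁] : V N i L₁ := by
  intro n e
  refine ⟨n, le_rfl, ?_⟩
  have : e = post e 0 := by
    conv_lhs => rw [← post_id e]
    congr 1
    ext x; exact Subsingleton.elim (α := L₁) _ _
  rw [this]
  simp [post, pre]

/-- half exactness in the first variable -/
lemma V_first {N₁ N₂ N₃ : ℕᵒᵖ ⥤ ModuleCat.{0} R} (f : N₁ ⟶ N₂) (g : N₂ ⟶ N₃)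
    (h0 : ∀ n, f.app n ≫ g.app n = 0)
    (hS : ∀ n, (ShortComplex.mk _ _ (h0 n)).ShortExact) (h₁ : V N₁ i L₁) (h₃ : V N₃ i L₁) :
    V N₂ i L₁ := by
  intro n e
  obtain ⟨m, hm, h0⟩ := h₁ n (pre (f.app _) e)
  rw [pre_comp, f.naturality, ← pre_comp] at h0
  obtain ⟨x, hx⟩ := Abelian.Ext.contravariant_sequence_exact₂ (hS _) _ _ h0
  obtain ⟨m', hm', h0'⟩ := h₃ m x
  refine ⟨m', hm.trans hm', ?_⟩
  have : N₂.map (homOfLE (hm.trans hm')).op = N₂.map (homOfLE hm').op ≫ N₂.map (homOfLE hm).op := by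
    rw [← N₂.map_comp]; rfl
  rw [this, ← pre_comp, ← hx]
  change pre _ (pre (g.app _) x) = 0
  rw [pre_comp, g.naturality, ← pre_comp, h0', pre_zero]

/-- Multiplication by `r` invertible on the target and zero on the source: no Ext. -/
lemma ext_eq_zero_of_smul {N : ModuleCat.{0} R} (r : R) (hN : ∀ x : N, r • x = 0)
    (hL : Function.Bijective (fun x : L₁ => r • x)) (e : E N (ModuleCat.of R L₁) i) : e = 0 := by
  have h1 : r • e = 0 := by
    have : e = pre (𝟙 N) e := (pre_id e).symm
    rw [this]
    unfold pre
    rw [← Abelian.Ext.smul_comp, ← Abelian.Ext.mk₀_smul]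
    have : r • 𝟙 N = 0 := by ext x; exact hN x
    rw [this]; simp
  rw [Abelian.Ext.smul_eq_comp_mk₀] at h1
  let f := LinearEquiv.ofBijective (LinearMap.lsmul R L₁ r) hL
  have h2 : post e (ModuleCat.ofHom f.toLinearMap) = 0 := by
    rw [← h1]; rfl
  rw [← post_id e]
  have : 𝟙 (ModuleCat.of R L₁) = ModuleCat.ofHom f.toLinearMap ≫ ModuleCat.ofHom f.symm.toLinearMap := by
    rw [← ModuleCat.ofHom_comp]; simp
  rw [this, ← post_comp, h2, post_zero]

end basics

end LC

namespace LC

section fg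

variable {R : Type} [CommRing R]

lemma exists_delta {S : ShortComplex (ModuleCat.{0} R)} (hS : S.ShortExact) [Projective S.X₂]
    {L : ModuleCat.{0} R} {i : ℕ} (e : E S.X₃ L (i + 1)) :
    ∃ x : E S.X₁ L i, hS.extClass.comp x (add_comm 1 i) = e := by
  apply Abelian.Ext.contravariant_sequence_exact₃
  exact Abelian.Ext.eq_zero_of_projective _

lemma pre_delta {S₁ S₂ : ShortComplex (ModuleCat.{0} R)} (h₁ : S₁.ShortExact) (h₂ : S₂.ShortExact)
    (f : S₁ ⟶ S₂) {L : ModuleCat.{0} R} {i : ℕ} (x : E S₂.X₁ L i) (hx : pre f.τ₁ x = 0) :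
    pre f.τ₃ (h₂.extClass.comp x (add_comm 1 i)) = 0 := by
  unfold pre at *
  rw [← Abelian.Ext.comp_assoc _ _ _ (zero_add 1) (add_comm 1 i) (by lia),
    ← ShortComplex.ShortExact.extClass_naturality h₁ h₂ f,
    Abelian.Ext.comp_assoc _ _ _ (add_zero 1) (zero_add i) (by lia), hx, Abelian.Ext.comp_zero]

/-- The presentation `0 → ker → R^m → N → 0`. -/
lemma exists_pres (N : Type) [AddCommGroup N] [Module R N] [Module.Finite R N] :
    ∃ (m : ℕ) (g : (Fin m → R) →ₗ[R] N), Function.Surjective g :=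
  Module.Finite.exists_fin' R N

lemma ext_fg [IsNoetherianRing R] {L : Type} [AddCommGroup L] [Module R L] (i : ℕ) :
    ∀ (N : Type) [AddCommGroup N] [Module R N] [Module.Finite R N]
      (e : E (ModuleCat.of R N) (ModuleCat.of R L) i),
      ∃ (L₀ : Submodule R L) (_ : L₀.FG) (e₀ : E (ModuleCat.of R N) (ModuleCat.of R L₀) i),
        post e₀ (ModuleCat.ofHom L₀.subtype) = e := by
  induction i with
  | zero =>
    intro N _ _ _ e
    obtain ⟨f, rfl⟩ := Abelian.Ext.mk₀_bijective _ _ |>.2 e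
    refine ⟨LinearMap.range f.hom, ?_, Abelian.Ext.mk₀ (ModuleCat.ofHom f.hom.rangeRestrict), ?_⟩
    · rw [← Module.Finite.iff_fg]; infer_instance
    · simp only [post, Abelian.Ext.mk₀_comp_mk₀]
      rfl
  | succ i ih =>
    intro N _ _ _ e
    obtain ⟨m, g, hg⟩ := exists_pres (R := R) N
    have hS := LinearMap.shortExact_shortComplexKer hg
    have : Projective (g.shortComplexKer).X₂ :=
      ModuleCat.projective_of_categoryTheory_projective (ModuleCat.of R (Fin m → R))
    obtain ⟨x, rfl⟩ := exists_delta hS e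
    obtain ⟨L₀, h0, e₀, rfl⟩ := ih _ x
    refine ⟨L₀, h0, hS.extClass.comp e₀ (add_comm 1 i), ?_⟩
    simp [post]

/-- `T` is `a`-torsion. -/
def Tors (a : Ideal R) (T : Type) [AddCommGroup T] [Module R T] : Prop :=
  ∀ x : T, ∃ k : ℕ, ∀ r ∈ a ^ k, r • x = 0

lemma tors_hom {a : Ideal R} {T : Type} [AddCommGroup T] [Module R T] (hT : Tors a T)
    {N : Type} [AddCommGroup N] [Module R N] [Module.Finite R N] (f : N →ₗ[R] T) :
    ∃ m : ℕ, a ^ m • (⊤ : Submodule R N) ≤ LinearMap.ker f := by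
  obtain ⟨s, hs⟩ := Module.finite_def.1 ‹Module.Finite R N›
  choose k hk using hT
  refine ⟨s.sup (fun x => k (f x)), ?_⟩
  rw [Submodule.smul_le]
  intro r hr x _
  have hx : x ∈ Submodule.span R (s : Set N) := by rw [hs]; trivial
  induction hx using Submodule.span_induction with
  | mem x hx =>
    rw [LinearMap.mem_ker, map_smul]
    exact hk _ r (Ideal.pow_le_pow_right (Finset.le_sup (f := fun x => k (f x)) hx) hr)
  | zero => simp
  | add x y _ _ hx hy => rw [smul_add]; exact add_mem (hx trivial) (hy trivial)
  | smul c x _ hx => rw [smul_comm]; exact Submodule.smul_mem _ _ (hx trivial)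

lemma pre_codRestrict {A B : Type} [AddCommGroup A] [Module R A] [AddCommGroup B] [Module R B]
    (t : A →ₗ[R] B) (P : Submodule R B) (h : ∀ z, t z ∈ P) {L : ModuleCat.{0} R} {i : ℕ}
    (x : E (ModuleCat.of R B) L i) (hx : pre (ModuleCat.ofHom P.subtype) x = 0) :
    pre (ModuleCat.ofHom t) x = 0 := by
  have : ModuleCat.ofHom t = ModuleCat.ofHom (t.codRestrict P h) ≫ ModuleCat.ofHom P.subtype := rfl
  rw [this, ← pre_comp, hx, pre_zero]

lemma pre_delta_sub {A N : Type} [AddCommGroup A] [Module R A] [AddCommGroup N] [Module R N]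
    (g : A →ₗ[R] N) (hg : Function.Surjective g) (P : Submodule R A) (Q : Submodule R N)
    (hPQ : P.map g = Q) (U : Submodule R (LinearMap.ker g))
    (hU : ∀ z : LinearMap.ker g, z.1 ∈ P → z ∈ U) {L : ModuleCat.{0} R} {i : ℕ}
    (x : E (ModuleCat.of R (LinearMap.ker g)) L i) (hx : pre (ModuleCat.ofHom U.subtype) x = 0) :
    pre (N := ModuleCat.of R N) (ModuleCat.ofHom Q.subtype)
      ((LinearMap.shortExact_shortComplexKer hg).extClass.comp x (add_comm 1 i)) = 0 := by
  have hmap : ∀ y ∈ P, g y ∈ Q := fun y hy => hPQ ▸ Submodule.mem_map_of_mem hy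
  let g' := g.restrict hmap
  have hg' : Function.Surjective g' := by
    rintro ⟨y, hy⟩
    rw [← hPQ] at hy
    obtain ⟨z, hz, rfl⟩ := hy
    exact ⟨⟨z, hz⟩, rfl⟩
  have hS' := LinearMap.shortExact_shortComplexKer hg'
  have hker : ∀ z : LinearMap.ker g', (z.1.1 : A) ∈ LinearMap.ker g := by
    rintro ⟨z, hz⟩
    exact congrArg Subtype.val (LinearMap.mem_ker.1 hz)
  let t1 : LinearMap.ker g' →ₗ[R] LinearMap.ker g :=
    LinearMap.codRestrict _ ((Submodule.subtype _).comp (Submodule.subtype _)) hker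
  have ht1 : ∀ z, t1 z ∈ U := fun z => hU _ z.1.2
  let F : g'.shortComplexKer ⟶ g.shortComplexKer :=
      { τ₁ := ModuleCat.ofHom t1
        τ₂ := ModuleCat.ofHom (Submodule.subtype _)
        τ₃ := ModuleCat.ofHom (Submodule.subtype _)
        comm₁₂ := rfl
        comm₂₃ := rfl }
  refine pre_delta hS' (LinearMap.shortExact_shortComplexKer hg) F x ?_
  exact pre_codRestrict t1 U ht1 x hx

lemma ext_tors [IsNoetherianRing R] {a : Ideal R} {T : Type} [AddCommGroup T] [Module R T]
    (hT : Tors a T) (i : ℕ) :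
    ∀ (N : Type) [AddCommGroup N] [Module R N] [Module.Finite R N]
      (e : E (ModuleCat.of R N) (ModuleCat.of R T) i),
      ∃ m : ℕ, pre (ModuleCat.ofHom (a ^ m • (⊤ : Submodule R N)).subtype) e = 0 := by
  induction i with
  | zero =>
    intro N _ _ _ e
    obtain ⟨f, rfl⟩ := Abelian.Ext.mk₀_bijective _ _ |>.2 e
    obtain ⟨m, hm⟩ := tors_hom hT f.hom
    refine ⟨m, ?_⟩
    simp only [pre, Abelian.Ext.mk₀_comp_mk₀]
    rw [Abelian.Ext.mk₀_eq_zero_iff]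
    ext x
    exact hm x.2
  | succ i ih =>
    intro N _ _ _ e
    obtain ⟨p, g, hg⟩ := exists_pres (R := R) N
    have hS := LinearMap.shortExact_shortComplexKer hg
    have : Projective (g.shortComplexKer).X₂ :=
      ModuleCat.projective_of_categoryTheory_projective (ModuleCat.of R (Fin p → R))
    obtain ⟨x, rfl⟩ := exists_delta hS e
    obtain ⟨m, hm⟩ := ih (LinearMap.ker g) x
    obtain ⟨k, hk⟩ := Ideal.exists_pow_inf_eq_pow_smul a (LinearMap.ker g)
    refine ⟨m + k, ?_⟩
    refine pre_delta_sub g hg (a ^ (m + k) • ⊤) (a ^ (m + k) • ⊤) ?_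
      (a ^ m • ⊤) ?_ x hm
    · rw [Submodule.map_smul'', Submodule.map_top, LinearMap.range_eq_top.2 hg]
    · intro z hz
      have h1 : (z : Fin p → R) ∈ a ^ (m + k) • ⊤ ⊓ LinearMap.ker g := ⟨hz, z.2⟩
      rw [hk _ (by lia), Nat.add_sub_cancel] at h1
      have h2 := Submodule.smul_mono (le_refl (a ^ m))
        (inf_le_right : a ^ k • ⊤ ⊓ LinearMap.ker g ≤ _) h1
      have h3 : a ^ m • LinearMap.ker g =
          Submodule.map (LinearMap.ker g).subtype (a ^ m • (⊤ : Submodule R (LinearMap.ker g))) := by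
        rw [Submodule.map_smul'', Submodule.map_top, Submodule.range_subtype]
      rw [h3] at h2
      obtain ⟨w, hw, hw'⟩ := h2
      rwa [← Subtype.ext hw']

/-- The inverse system `R / a ^ n`. -/
abbrev S (a : Ideal R) : ℕᵒᵖ ⥤ ModuleCat.{0} R :=
  localCohomology.ringModIdeals (localCohomology.idealPowersDiagram a)

lemma V_tors [IsNoetherianRing R] {a : Ideal R} {T : Type} [AddCommGroup T] [Module R T]
    (hT : Tors a T) (i : ℕ) : V (S a) (i + 1) T := by
  intro n e
  have hS (n : ℕ) := shortExact (Submodule.subtype (a ^ n)) (Submodule.mkQ (a ^ n))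
    (Submodule.injective_subtype _) (Submodule.mkQ_surjective _)
    (LinearMap.exact_subtype_mkQ (a ^ n))
  have : Projective (ModuleCat.of R R) :=
      ModuleCat.projective_of_categoryTheory_projective (ModuleCat.of R R)
  obtain ⟨x, hx⟩ := exists_delta (hS n) e
  obtain ⟨m, hm⟩ := ext_tors hT i _ x
  refine ⟨n + m, by lia, ?_⟩
  rw [← hx]
  have hle : a ^ (n + m) ≤ a ^ n := Ideal.pow_le_pow_right (by lia)
  let F : ModuleCat.shortComplexOfCompEqZero (Submodule.subtype (a ^ (n + m)))
      (Submodule.mkQ (a ^ (n + m))) (LinearMap.exact_subtype_mkQ _).linearMap_comp_eq_zero ⟶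
     ModuleCat.shortComplexOfCompEqZero (Submodule.subtype (a ^ n))
      (Submodule.mkQ (a ^ n)) (LinearMap.exact_subtype_mkQ _).linearMap_comp_eq_zero :=
      { τ₁ := ModuleCat.ofHom (Submodule.inclusion hle)
        τ₂ := 𝟙 _
        τ₃ := (S a).map (homOfLE (by lia : n ≤ n + m)).op
        comm₁₂ := rfl
        comm₂₃ := rfl }
  refine pre_delta (hS (n + m)) (hS n) F x ?_
  have ht : ∀ z, Submodule.inclusion hle z ∈ a ^ m • (⊤ : Submodule R (a ^ n : Ideal R)) := by
    intro z
    have h3 : a ^ m • (a ^ n : Submodule R R) =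
          Submodule.map (Submodule.subtype (a ^ n)) (a ^ m • (⊤ : Submodule R (a ^ n : Ideal R))) := by
        rw [Submodule.map_smul'', Submodule.map_top, Submodule.range_subtype]
    have h2 : (z : R) ∈ a ^ m • (a ^ n : Submodule R R) := by
      rw [smul_eq_mul, ← pow_add, add_comm]; exact z.2
    rw [h3] at h2
    obtain ⟨w, hw, hw'⟩ := h2
    have : w = Submodule.inclusion hle z := Subtype.ext hw'
    rwa [← this]
  have : F.τ₁ = ModuleCat.ofHom (LinearMap.codRestrict _ (Submodule.inclusion hle) ht) ≫
      ModuleCat.ofHom (a ^ m • (⊤ : Submodule R (a ^ n : Ideal R))).subtype := rfl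
  rw [this, ← pre_comp, hm, pre_zero]

/-- Vanishing on finitely generated submodules implies vanishing. -/
lemma V_of_fg [IsNoetherianRing R] {a : Ideal R} {L : Type} [AddCommGroup L] [Module R L] (i : ℕ)
    (h : ∀ L₀ : Submodule R L, L₀.FG → V (S a) i L₀) : V (S a) i L := by
  intro n e
  have : Module.Finite R ((S a).obj (op n)) :=
    inferInstanceAs (Module.Finite R (R ⧸ (a ^ n : Ideal R)))
  have key := ext_fg (R := R) (L := L) i ((S a).obj (op n))
  obtain ⟨L₀, h0, e₀, rfl⟩ := key e
  obtain ⟨m, hm, h1⟩ := h L₀ h0 n e₀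
  refine ⟨m, hm, ?_⟩
  change pre _ (post e₀ _) = 0
  rw [pre_post, h1, post_zero]

end fg

end LC

namespace LC

section homs

variable {R : Type} [CommRing R]

open TensorProduct in
lemma exists_hom_residue (M : Type) [AddCommGroup M] [Module R M] [Module.Finite R M]
    (p : Ideal R) [hp : p.IsPrime] (hM : Module.annihilator R M ≤ p) :
    ∃ f : M →ₗ[R] p.ResidueField, f ≠ 0 := by
  let A := Localization.AtPrime p
  let Mp := LocalizedModule p.primeCompl M
  have hsupp : (⟨p, hp⟩ : PrimeSpectrum R) ∈ Module.support R M := by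
    rw [Module.support_eq_zeroLocus]; exact hM
  have hnt : Nontrivial Mp := hsupp
  have hnt' : Nontrivial (p.ResidueField ⊗[A] Mp) := by
    by_contra h
    rw [not_nontrivial_iff_subsingleton] at h
    have := (IsLocalRing.subsingleton_tensorProduct (R := A) (M := Mp)).1 h
    exact not_subsingleton Mp this
  obtain ⟨x, hx⟩ := exists_ne (0 : p.ResidueField ⊗[A] Mp)
  obtain ⟨f, hf⟩ := Module.Projective.exists_dual_ne_zero p.ResidueField hx
  let g : Mp →ₗ[A] p.ResidueField := (f.restrictScalars A).comp (TensorProduct.mk A _ Mp 1)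
  let φ := LocalizedModule.mkLinearMap p.primeCompl M
  refine ⟨(g.restrictScalars R).comp φ, fun h0 => hf ?_⟩
  have hg : ∀ y : Mp, g y = 0 := by
    intro y
    obtain ⟨⟨z, s⟩, hz⟩ := IsLocalizedModule.surj p.primeCompl φ y
    have h1 : (s : R) • g y = 0 := by
      have := LinearMap.congr_fun h0 z
      have h2 : (g.restrictScalars R) (s • y) = 0 := by rw [hz]; exact this
      rw [← h2, Submonoid.smul_def, map_smul]; rfl
    have h3 : algebraMap R p.ResidueField (s : R) ≠ 0 := by
      intro h
      rw [Ideal.algebraMap_residueField_eq_zero] at h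
      exact s.2 h
    rw [Algebra.smul_def] at h1
    exact (mul_eq_zero.1 h1).resolve_left h3
  clear hf hx
  induction x using TensorProduct.induction_on with
  | zero => simp
  | tmul c y =>
    have : c ⊗ₜ[A] y = c • ((1 : p.ResidueField) ⊗ₜ[A] y) := by simp [TensorProduct.smul_tmul']
    rw [this, map_smul]
    have := hg y
    change f _ = 0 at this
    change c • f ((1 : p.ResidueField) ⊗ₜ[A] y) = 0
    erw [this]; simp
  | add x y hx hy =>
    rw [map_add, hx, hy, add_zero]

lemma exists_hom_quotient (M : Type) [AddCommGroup M] [Module R M] [Module.Finite R M]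
    (p : Ideal R) [hp : p.IsPrime] (hM : Module.annihilator R M ≤ p) :
    ∃ f : M →ₗ[R] (R ⧸ p), f ≠ 0 := by
  obtain ⟨f, hf⟩ := exists_hom_residue M p hM
  obtain ⟨s, hs⟩ := Module.finite_def.1 ‹Module.Finite R M›
  obtain ⟨c, hc⟩ := IsLocalization.exist_integer_multiples (nonZeroDivisors (R ⧸ p)) s f
  obtain ⟨r, hr⟩ := Ideal.Quotient.mk_surjective (c : R ⧸ p)
  let ι : (R ⧸ p) →ₗ[R] p.ResidueField :=
    (IsScalarTower.toAlgHom R (R ⧸ p) p.ResidueField).toLinearMap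
  have hι : Function.Injective ι := IsFractionRing.injective (R ⧸ p) p.ResidueField
  have hr' : ∀ y : p.ResidueField, r • y = (c : R ⧸ p) • y := by
    intro y
    rw [← hr]
    exact (algebraMap_smul (R ⧸ p) r y).symm
  have h1 : ∀ x, (r • f) x ∈ LinearMap.range ι := by
    intro x
    have hx : x ∈ Submodule.span R (s : Set M) := by rw [hs]; trivial
    have : Submodule.span R (s : Set M) ≤ (LinearMap.range ι).comap (r • f) := by
      rw [Submodule.span_le]
      intro x hx
      obtain ⟨y, hy⟩ := hc x hx
      refine ⟨y, ?_⟩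
      rw [LinearMap.smul_apply, hr']
      exact hy
    exact this hx
  let e := LinearEquiv.ofInjective ι hι
  refine ⟨e.symm.toLinearMap.comp ((r • f).codRestrict _ h1), fun h0 => hf ?_⟩
  ext x
  have h2 := LinearMap.congr_fun h0 x
  have h3 : (r • f).codRestrict _ h1 x = 0 := by
    apply e.symm.injective
    rw [map_zero]; exact h2
  have h4 : r • f x = 0 := congrArg Subtype.val h3
  rw [hr', Algebra.smul_def] at h4
  refine (mul_eq_zero.1 h4).resolve_left ?_
  intro h
  have := IsFractionRing.injective (R ⧸ p) p.ResidueField (h.trans (map_zero _).symm)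
  exact nonZeroDivisors.coe_ne_zero c this

end homs

end LC

namespace LC

section bound

variable {R : Type} [CommRing R]

lemma pow_bij {L : Type} [AddCommGroup L] [Module R L] {f : R}
    (h : Function.Bijective (fun x : L => f • x)) (n : ℕ) :
    Function.Bijective (fun x : L => f ^ n • x) := by
  induction n with
  | zero => simp only [pow_zero, one_smul]; exact Function.bijective_id
  | succ n ih =>
    have : (fun x : L => f ^ (n + 1) • x) = (fun x : L => f ^ n • x) ∘ (fun x : L => f • x) := by
      funext x; simp [pow_succ, mul_smul]
    rw [this]; exact ih.comp h

lemma smul_S (a : Ideal R) (n : ℕ) (r : R) (hr : r ∈ a ^ n) (x : (S a).obj (op n)) : r • x = 0 := by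
  change R ⧸ (a ^ n) at x
  obtain ⟨y, rfl⟩ := Ideal.Quotient.mk_surjective x
  change Ideal.Quotient.mk (a ^ n) (r * y) = 0
  rw [Ideal.Quotient.eq_zero_iff_mem]
  exact Ideal.mul_mem_right _ _ hr

lemma V_bij (a : Ideal R) {f : R} (hf : f ∈ a) {L : Type} [AddCommGroup L] [Module R L]
    (h : Function.Bijective (fun x : L => f • x)) (i : ℕ) : V (S a) i L := by
  intro n e
  refine ⟨n, le_rfl, ?_⟩
  rw [ext_eq_zero_of_smul (f ^ n) (smul_S a n _ (Ideal.pow_mem_pow hf n)) (pow_bij h n) e, pre_zero]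

/-- localization at one element -/
abbrev Loc (f : R) (L : Type) [AddCommGroup L] [Module R L] : Type :=
  LocalizedModule (Submonoid.powers f) L

lemma loc_bij (f : R) (L : Type) [AddCommGroup L] [Module R L] :
    Function.Bijective (fun x : Loc f L => f • x) := by
  have h := IsLocalizedModule.map_units
    (LocalizedModule.mkLinearMap (Submonoid.powers f) L) ⟨f, Submonoid.mem_powers f⟩
  exact (Module.End.isUnit_iff _).1 h

lemma loc_ker (f : R) (L : Type) [AddCommGroup L] [Module R L] (x : L)
    (hx : LocalizedModule.mkLinearMap (Submonoid.powers f) L x = 0) : ∃ k : ℕ, f ^ k • x = 0 := by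
  obtain ⟨⟨_, k, rfl⟩, hc⟩ := (IsLocalizedModule.eq_zero_iff (Submonoid.powers f)
    (LocalizedModule.mkLinearMap (Submonoid.powers f) L)).1 hx
  exact ⟨k, hc⟩

lemma loc_surj (f : R) (L : Type) [AddCommGroup L] [Module R L] (y : Loc f L) :
    ∃ (k : ℕ) (x : L), f ^ k • y = LocalizedModule.mkLinearMap (Submonoid.powers f) L x := by
  obtain ⟨⟨x, ⟨_, k, rfl⟩⟩, hc⟩ := IsLocalizedModule.surj (Submonoid.powers f)
    (LocalizedModule.mkLinearMap (Submonoid.powers f) L) y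
  exact ⟨k, x, hc⟩

lemma tors_of_gens {a : Ideal R} (G : Finset R) (hG : Ideal.span (G : Set R) = a)
    {T : Type} [AddCommGroup T] [Module R T]
    (h : ∀ (x : T), ∀ g ∈ G, ∃ k : ℕ, g ^ k • x = 0) : Tors a T := by
  intro x
  have h1 : a ≤ (Ideal.torsionOf R T x).radical := by
    rw [← hG, Ideal.span_le]
    intro g hg
    obtain ⟨k, hk⟩ := h x g hg
    exact ⟨k, hk⟩
  obtain ⟨k, hk⟩ := Ideal.exists_pow_le_of_le_radical_of_fg h1 ⟨G, hG⟩
  exact ⟨k, fun r hr => hk hr⟩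

/-- exact sequences attached to a linear map -/
lemma exact_ker_range {L L' : Type} [AddCommGroup L] [Module R L] [AddCommGroup L'] [Module R L']
    (φ : L →ₗ[R] L') : Function.Exact (LinearMap.ker φ).subtype φ.rangeRestrict := by
  rw [LinearMap.exact_iff, LinearMap.ker_rangeRestrict, Submodule.range_subtype]

lemma Q [IsNoetherianRing R] (a : Ideal R) (G : Finset R) (hG : Ideal.span (G : Set R) = a)
    (t : Finset R) : t ⊆ G → ∀ (T : Type) [AddCommGroup T] [Module R T],
      (∀ (x : T), ∀ g ∈ G, g ∉ t → ∃ k : ℕ, g ^ k • x = 0) → ∀ i, t.card < i → V (S a) i T := by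
  classical
  induction t using Finset.induction_on with
  | empty =>
    intro _ T _ _ h i hi
    obtain ⟨i, rfl⟩ := Nat.exists_eq_succ_of_ne_zero (Nat.pos_iff_ne_zero.1 hi)
    exact V_tors (tors_of_gens G hG (fun x g hg => h x g hg (by simp))) i
  | insert f t hft ih =>
    intro ht T _ _ h i hi
    rw [Finset.card_insert_of_notMem hft] at hi
    obtain ⟨i, rfl⟩ := Nat.exists_eq_succ_of_ne_zero (Nat.pos_iff_ne_zero.1 (lt_of_le_of_lt (Nat.zero_le _) hi))
    have ht' : t ⊆ G := (Finset.subset_insert _ _).trans ht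
    have hfG : f ∈ G := ht (Finset.mem_insert_self _ _)
    have hfa : f ∈ a := hG ▸ Ideal.subset_span hfG
    let φ := LocalizedModule.mkLinearMap (Submonoid.powers f) T
    have hK : V (S a) (i + 1) (LinearMap.ker φ) := by
      apply ih ht' _ _ _ (by lia)
      rintro ⟨x, hx⟩ g hg hgt
      by_cases hgf : g = f
      · subst hgf
        obtain ⟨k, hk⟩ := loc_ker g T x hx
        exact ⟨k, Subtype.ext hk⟩
      · obtain ⟨k, hk⟩ := h x g hg (by simp [hgf, hgt])
        exact ⟨k, Subtype.ext hk⟩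
    have hC : V (S a) i (Loc f T ⧸ LinearMap.range φ) := by
      apply ih ht' _ _ _ (by lia)
      intro x g hg hgt
      obtain ⟨y, rfl⟩ := Submodule.mkQ_surjective _ x
      obtain ⟨k, z, hk⟩ := loc_surj f T y
      by_cases hgf : g = f
      · subst hgf
        refine ⟨k, ?_⟩
        rw [← map_smul, hk]
        exact (Submodule.Quotient.mk_eq_zero _).2 ⟨z, rfl⟩
      · obtain ⟨l, hl⟩ := h z g hg (by simp [hgf, hgt])
        refine ⟨l, ?_⟩
        have : f ^ k • (g ^ l • y) = 0 := by
          rw [smul_comm, hk, ← map_smul, hl, map_zero]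
        have h0 : g ^ l • y = 0 := (pow_bij (loc_bij f T) k).1 (by simpa using this)
        rw [← map_smul, h0, map_zero]
    have hE : V (S a) (i + 1) (Loc f T) := V_bij a hfa (loc_bij f T) _
    have hR : V (S a) (i + 1) (LinearMap.range φ) :=
      V_left (LinearMap.range φ).subtype (LinearMap.range φ).mkQ (Submodule.injective_subtype _)
        (Submodule.mkQ_surjective _) (LinearMap.exact_subtype_mkQ _) hC hE
    exact V_mid (LinearMap.ker φ).subtype φ.rangeRestrict (Submodule.injective_subtype _)
        (LinearMap.surjective_rangeRestrict _) (exact_ker_range φ) hK hR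

lemma exists_bound [IsNoetherianRing R] (a : Ideal R) : ∃ N : ℕ, ∀ i, N < i →
    ∀ (T : Type) [AddCommGroup T] [Module R T], V (S a) i T := by
  obtain ⟨G, hG⟩ : a.FG := IsNoetherian.noetherian a
  exact ⟨G.card, fun i hi T _ _ => Q a G hG G subset_rfl T (fun x g h h' => absurd h h') i hi⟩

/-- `L` is killed by `I` -/
def Kills (I : Ideal R) (L : Type) [AddCommGroup L] [Module R L] : Prop :=
  ∀ r ∈ I, ∀ x : L, r • x = 0

lemma Kills.of_injective {I : Ideal R} {L L' : Type} [AddCommGroup L] [Module R L] [AddCommGroup L']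
    [Module R L'] (h : Kills I L') (f : L →ₗ[R] L') (hf : Function.Injective f) : Kills I L := by
  intro r hr x
  apply hf
  rw [map_smul, h r hr, map_zero]

lemma Kills.of_surjective {I : Ideal R} {L L' : Type} [AddCommGroup L] [Module R L] [AddCommGroup L']
    [Module R L'] (h : Kills I L) (f : L →ₗ[R] L') (hf : Function.Surjective f) : Kills I L' := by
  intro r hr x
  obtain ⟨y, rfl⟩ := hf x
  rw [← map_smul, h r hr, map_zero]

lemma Kills.mono {I I' : Ideal R} {L : Type} [AddCommGroup L] [Module R L] (h : Kills I L)
    (hI : I' ≤ I) : Kills I' L := fun r hr => h r (hI hr)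

lemma kills_quot (I : Ideal R) : Kills I (R ⧸ I) := by
  intro r hr x
  obtain ⟨y, rfl⟩ := Ideal.Quotient.mk_surjective x
  change Ideal.Quotient.mk I (r * y) = 0
  rw [Ideal.Quotient.eq_zero_iff_mem]
  exact Ideal.mul_mem_right _ _ hr

lemma A_core [IsNoetherianRing R] (a : Ideal R) (M : Type) [AddCommGroup M] [Module R M]
    [Module.Finite R M] (i : ℕ) (hM : V (S a) i M)
    (hnext : ∀ (L : Type) [AddCommGroup L] [Module R L], Kills (Module.annihilator R M) L →
      V (S a) (i + 1) L) (I : Ideal R) (hI : Module.annihilator R M ≤ I) :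
    ∀ (L : Type) [AddCommGroup L] [Module R L] [Module.Finite R L], Kills I L → V (S a) i L := by
  induction I using IsNoetherian.induction with
  | hgt I ih =>
  intro L _ _ _
  refine IsNoetherianRing.induction_on_isQuotientEquivQuotientPrime (A := R) (M := L) inferInstance
    (motive := fun L _ _ _ => Kills I L → V (S a) i L) ?_ ?_ ?_
  · intro N _ _ _ _ _
    exact V_subsingleton
  · intro N _ _ _ p e hN
    have hp := p.2
    have hQ : Kills I (R ⧸ p.1) := hN.of_surjective e.toLinearMap e.surjective
    have hIp : I ≤ p.1 := by
      intro r hr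
      have := hQ r hr 1
      have h2 : Ideal.Quotient.mk p.1 (r * 1) = 0 := this
      rwa [mul_one, Ideal.Quotient.eq_zero_iff_mem] at h2
    refine V_equiv e.symm ?_
    rcases hIp.lt_or_eq with hlt | rfl
    · exact ih p.1 hlt (hI.trans hIp) _ (kills_quot _)
    obtain ⟨φ, hφ⟩ := exists_hom_quotient M p.1 hI
    have hkM : Kills (Module.annihilator R M) M := fun r hr x => Module.mem_annihilator.1 hr x
    have hR : V (S a) i (LinearMap.range φ) :=
      V_right (LinearMap.ker φ).subtype φ.rangeRestrict (Submodule.injective_subtype _)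
        (LinearMap.surjective_rangeRestrict _) (exact_ker_range φ) hM
        (hnext _ (hkM.of_injective _ (Submodule.injective_subtype _)))
    have hC : V (S a) i ((R ⧸ p.1) ⧸ LinearMap.range φ) := by
      obtain ⟨m, hm⟩ : ∃ m, φ m ≠ 0 := by
        by_contra! h
        exact hφ (LinearMap.ext h)
      obtain ⟨r, hr⟩ := Ideal.Quotient.mk_surjective (φ m)
      have hrp : r ∉ p.1 := by
        intro h
        rw [← Ideal.Quotient.eq_zero_iff_mem, hr] at h
        exact hm h
      have hlt : p.1 < p.1 ⊔ Ideal.span {r} := by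
        refine lt_of_le_of_ne le_sup_left (fun h => hrp ?_)
        rw [h]
        exact Ideal.mem_sup_right (Ideal.mem_span_singleton_self r)
      refine ih _ hlt (hI.trans le_sup_left) _ ?_
      have h1 : Kills p.1 ((R ⧸ p.1) ⧸ LinearMap.range φ) :=
        (kills_quot p.1).of_surjective (LinearMap.range φ).mkQ (Submodule.mkQ_surjective _)
      have h2 : p.1 ⊔ Ideal.span {r} ≤ Module.annihilator R ((R ⧸ p.1) ⧸ LinearMap.range φ) := by
        refine sup_le (fun s hs => Module.mem_annihilator.2 (h1 s hs)) ?_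
        rw [Ideal.span_singleton_le_iff_mem, Module.mem_annihilator]
        intro x
        obtain ⟨y, rfl⟩ := Submodule.mkQ_surjective _ x
        obtain ⟨s, rfl⟩ := Ideal.Quotient.mk_surjective y
        rw [← map_smul]
        refine (Submodule.Quotient.mk_eq_zero _).2 ⟨s • m, ?_⟩
        rw [map_smul, ← hr]
        change Ideal.Quotient.mk p.1 (s * r) = Ideal.Quotient.mk p.1 (r * s)
        rw [mul_comm]
      exact fun s hs x => Module.mem_annihilator.1 (h2 hs) x
    exact V_mid (LinearMap.range φ).subtype (LinearMap.range φ).mkQ (Submodule.injective_subtype _)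
        (Submodule.mkQ_surjective _) (LinearMap.exact_subtype_mkQ _) hR hC
  · intro N₁ _ _ _ N₂ _ _ _ N₃ _ _ _ f g hf hg hfg h1 h3 hN
    exact V_mid f g hf hg hfg (h1 (hN.of_injective f hf)) (h3 (hN.of_surjective g hg))

lemma A_main [IsNoetherianRing R] (a : Ideal R) (M : Type) [AddCommGroup M] [Module R M]
    [Module.Finite R M] (c : ℕ) (hM : ∀ i, c < i → V (S a) i M) :
    ∀ i, c < i → ∀ (L : Type) [AddCommGroup L] [Module R L], Kills (Module.annihilator R M) L →
      V (S a) i L := by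
  obtain ⟨N, hN⟩ := exists_bound a
  have key : ∀ d i, c < i → N < i + d → ∀ (L : Type) [AddCommGroup L] [Module R L],
      Kills (Module.annihilator R M) L → V (S a) i L := by
    intro d
    induction d with
    | zero => intro i _ hi L _ _ _; exact hN i hi L
    | succ d ih =>
      intro i hi hd L _ _ hL
      refine V_of_fg i fun L₀ h0 => ?_
      have : Module.Finite R L₀ := Module.Finite.iff_fg.2 h0
      exact A_core a M i (hM i hi) (ih (i + 1) (by lia) (by lia)) _ le_rfl L₀
        (hL.of_injective L₀.subtype (Submodule.injective_subtype _))
  intro i hi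
  exact key (N + 1) i hi (by lia)

end bound

end LC

namespace LC

section main

variable {R : Type} [CommRing R]

lemma ext_pi_zero {ι : Type} [Fintype ι] (F : ι → Type) [∀ j, AddCommGroup (F j)]
    [∀ j, Module R (F j)] {N : ModuleCat.{0} R} {i : ℕ}
    (e : E N (ModuleCat.of R (∀ j, F j)) i)
    (h : ∀ j, post e (ModuleCat.ofHom (LinearMap.proj (R := R) (φ := F) j)) = 0) : e = 0 := by
  classical
  have hid : (𝟙 (ModuleCat.of R (∀ j, F j))) = ∑ j, ModuleCat.ofHom (LinearMap.proj (R := R) (φ := F) j) ≫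
      ModuleCat.ofHom (LinearMap.single R F j) := by
    apply ModuleCat.hom_ext
    rw [ModuleCat.hom_sum]
    ext x j
    simp [Finset.sum_apply]
  have hsum : ∀ (s : Finset ι) (g : ι → (ModuleCat.of R (∀ j, F j) ⟶ ModuleCat.of R (∀ j, F j))),
      (∀ j, post e (g j) = 0) → post e (∑ j ∈ s, g j) = 0 := by
    intro s g hg
    induction s using Finset.induction_on with
    | empty => simp [post]
    | insert j s hj ih =>
      rw [Finset.sum_insert hj]
      unfold post at *
      rw [Abelian.Ext.mk₀_add, Abelian.Ext.comp_add, ih, hg, add_zero]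
  rw [← post_id e, hid]
  apply hsum
  intro j
  rw [← post_comp, h, post_zero]

lemma exists_res [IsNoetherianRing R] (b : Ideal R) (L : Type) [AddCommGroup L] [Module R L] :
    ∃ (F : Type) (_ : AddCommGroup F) (_ : Module R F) (φ : L →ₗ[R] F),
      (∀ I : Ideal R, Kills I L → Kills I F) ∧ Tors b (LinearMap.ker φ) ∧
      ∀ (N : ModuleCat.{0} R) (n : ℕ), (∀ r ∈ b ^ n, ∀ x : N, r • x = 0) →
        ∀ i (e : E N (ModuleCat.of R F) i), e = 0 := by
  obtain ⟨G, hG⟩ : b.FG := IsNoetherian.noetherian b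
  refine ⟨∀ g : G, Loc g.1 L, inferInstance, inferInstance,
    LinearMap.pi (fun g => LocalizedModule.mkLinearMap (Submonoid.powers g.1) L), ?_, ?_, ?_⟩
  · intro I hI r hr x
    funext g
    change r • x g = 0
    obtain ⟨k, z, hz⟩ := loc_surj g.1 L (x g)
    apply (pow_bij (loc_bij g.1 L) k).1
    change g.1 ^ k • r • x g = g.1 ^ k • 0
    rw [smul_comm, hz, ← map_smul, hI r hr, map_zero, smul_zero]
  · apply tors_of_gens G hG
    rintro ⟨x, hx⟩ g hg
    obtain ⟨k, hk⟩ := loc_ker g L x (congrFun (LinearMap.mem_ker.1 hx) ⟨g, hg⟩)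
    exact ⟨k, Subtype.ext hk⟩
  · intro N n hN i e
    apply ext_pi_zero
    intro g
    refine ext_eq_zero_of_smul (g.1 ^ n) (fun x => hN _ ?_ x) (pow_bij (loc_bij g.1 L) n) _
    exact Ideal.pow_mem_pow (hG ▸ Ideal.subset_span g.2) n

/-- The map of systems `R/(ab)^n → R/a^n`. -/
noncomputable def proj (a b : Ideal R) : S (a * b) ⟶ S a where
  app n := ModuleCat.ofHom (Submodule.mapQ ((a * b) ^ n.unop) (a ^ n.unop) LinearMap.id
    (Ideal.pow_right_mono Ideal.mul_le_left _))
  naturality n m f := by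
    apply ModuleCat.hom_ext
    apply Submodule.linearMap_qext
    rfl

/-- The kernel of a map of systems. -/
noncomputable def kerSys {N₂ N₃ : ℕᵒᵖ ⥤ ModuleCat.{0} R} (f : N₂ ⟶ N₃) :
    ℕᵒᵖ ⥤ ModuleCat.{0} R where
  obj n := ModuleCat.of R (LinearMap.ker (f.app n).hom)
  map {n m} h := ModuleCat.ofHom ((N₂.map h).hom.restrict (fun x hx => by
    have := congrArg (fun t => t.hom x) (f.naturality h)
    simp only [ModuleCat.hom_comp, LinearMap.comp_apply] at this
    rw [LinearMap.mem_ker] at hx ⊢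
    rw [this, hx, map_zero]))
  map_id n := by
    apply ModuleCat.hom_ext
    ext x
    simp
  map_comp f g := by
    apply ModuleCat.hom_ext
    ext x
    simp

/-- The inclusion of the kernel system. -/
noncomputable def kerSysι {N₂ N₃ : ℕᵒᵖ ⥤ ModuleCat.{0} R} (f : N₂ ⟶ N₃) : kerSys f ⟶ N₂ where
  app n := ModuleCat.ofHom (LinearMap.ker (f.app n).hom).subtype
  naturality _ _ _ := rfl

lemma kills_kerSys (a b : Ideal R) (n : ℕ) (r : R) (hr : r ∈ b ^ n)
    (x : (kerSys (proj a b)).obj (op n)) : r • x = 0 := by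
  obtain ⟨x, hx⟩ := x
  apply Subtype.ext
  change r • x = 0
  change R ⧸ ((a * b) ^ n) at x
  obtain ⟨y, rfl⟩ := Ideal.Quotient.mk_surjective x
  have hy : Ideal.Quotient.mk (a ^ n) y = 0 := hx
  rw [Ideal.Quotient.eq_zero_iff_mem] at hy
  change Ideal.Quotient.mk ((a * b) ^ n) (r * y) = 0
  rw [Ideal.Quotient.eq_zero_iff_mem, mul_pow, mul_comm r y]
  exact Ideal.mul_mem_mul hy hr

lemma V_mul (a b : Ideal R) {L : Type} [AddCommGroup L] [Module R L] {i : ℕ}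
    (h₁ : V (kerSys (proj a b)) i L) (h₂ : V (S a) i L) : V (S (a * b)) i L := by
  refine V_first (kerSysι (proj a b)) (proj a b) ?_ ?_ h₁ h₂
  · intro n
    apply ModuleCat.hom_ext
    ext x
    exact x.2
  · intro n
    refine ModuleCat.shortComplex_shortExact _ ?_ ?_ ?_
    · intro x
      constructor
      · intro h; exact ⟨⟨x, h⟩, rfl⟩
      · rintro ⟨y, rfl⟩; exact y.2
    · exact Subtype.val_injective
    · intro x
      change R ⧸ (a ^ n.unop) at x
      obtain ⟨y, rfl⟩ := Ideal.Quotient.mk_surjective x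
      exact ⟨Ideal.Quotient.mk _ y, rfl⟩

lemma ker_eq_zero (b : Ideal R) {L : Type} [AddCommGroup L] [Module R L] {K : Submodule R L}
    (hK : Tors b K) (h : V (S b) 0 L) : ∀ x ∈ K, x = 0 := by
  intro x hx
  obtain ⟨k, hk⟩ := hK ⟨x, hx⟩
  let f : (R ⧸ b ^ k) →ₗ[R] L := (b ^ k).liftQ (LinearMap.toSpanSingleton R L x) (by
    intro r hr
    have := congrArg Subtype.val (hk r hr)
    simpa using this)
  let f' : (S b).obj (op k) ⟶ ModuleCat.of R L := ModuleCat.ofHom f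
  obtain ⟨m, hm, h0⟩ := h k (Abelian.Ext.mk₀ f')
  unfold pre at h0
  rw [Abelian.Ext.mk₀_comp_mk₀, Abelian.Ext.mk₀_eq_zero_iff] at h0
  have := congrArg (fun t => t.hom (Ideal.Quotient.mk (b ^ m) 1)) h0
  have h2 : (1 : R) • x = 0 := this
  simpa using h2

lemma V_of_zero {N : ℕᵒᵖ ⥤ ModuleCat.{0} R} {i : ℕ} {L : Type} [AddCommGroup L] [Module R L]
    (h : ∀ n (e : E (N.obj (op n)) (ModuleCat.of R L) i), e = 0) : V N i L := by
  intro n e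
  refine ⟨n, le_rfl, ?_⟩
  rw [h n e, pre_zero]

lemma V_ker [IsNoetherianRing R] (a b : Ideal R) (i : ℕ) : ∀ (L : Type) [AddCommGroup L] [Module R L],
    (∀ j, V (S b) j L) → V (kerSys (proj a b)) i L := by
  induction i with
  | zero =>
    intro L _ _ h
    obtain ⟨F, _, _, φ, -, h2, h3⟩ := exists_res b L
    have hinj : Function.Injective φ := by
      rw [← LinearMap.ker_eq_bot, Submodule.eq_bot_iff]
      exact ker_eq_zero b h2 (h 0)
    exact V_left_zero φ hinj (V_of_zero fun n e => h3 _ n (kills_kerSys a b n) 0 e)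
  | succ i ih =>
    intro L _ _ h
    obtain ⟨F, _, _, φ, -, h2, h3⟩ := exists_res b L
    have hinj : Function.Injective φ := by
      rw [← LinearMap.ker_eq_bot, Submodule.eq_bot_iff]
      exact ker_eq_zero b h2 (h 0)
    have hex : Function.Exact φ (LinearMap.range φ).mkQ := LinearMap.exact_map_mkQ_range φ
    refine V_left φ (LinearMap.range φ).mkQ hinj (Submodule.mkQ_surjective _) hex
      (ih _ fun j => ?_) (V_of_zero fun n e => h3 _ n (kills_kerSys a b n) _ e)
    exact V_right φ (LinearMap.range φ).mkQ hinj (Submodule.mkQ_surjective _) hex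
      (V_of_zero fun n e => h3 _ n (smul_S b n) _ e) (h _)

lemma P [IsNoetherianRing R] (a b : Ideal R) (J : Ideal R) (c : ℕ)
    (hA : ∀ i, c < i → ∀ (L : Type) [AddCommGroup L] [Module R L], Kills J L → V (S a) i L) (k : ℕ) :
    ∀ (L : Type) [AddCommGroup L] [Module R L], Kills J L → (∀ i, k < i → V (S b) i L) →
      ∀ i, c + k < i → V (S (a * b)) i L := by
  induction k with
  | zero =>
    intro L _ _ hL h i hi
    obtain ⟨i, rfl⟩ := Nat.exists_eq_succ_of_ne_zero (Nat.pos_iff_ne_zero.1 (lt_of_le_of_lt (Nat.zero_le _) hi))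
    obtain ⟨F, _, _, φ, -, h2, h3⟩ := exists_res b L
    have h2' : Tors (a * b) (LinearMap.ker φ) := fun x =>
      (h2 x).imp fun k hk r hr => hk r (Ideal.pow_right_mono Ideal.mul_le_right _ hr)
    have hJ : Kills J (LinearMap.range φ) :=
      hL.of_surjective φ.rangeRestrict (LinearMap.surjective_rangeRestrict _)
    refine V_mid (LinearMap.ker φ).subtype φ.rangeRestrict (Submodule.injective_subtype _)
        (LinearMap.surjective_rangeRestrict _) (exact_ker_range φ) (V_tors h2' i) ?_
    refine V_mul a b (V_ker a b _ _ fun j => ?_) (hA _ hi _ hJ)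
    rcases Nat.eq_zero_or_pos j with rfl | hj
    · exact V_left_zero (LinearMap.range φ).subtype (Submodule.injective_subtype _)
        (V_of_zero fun n e => h3 _ n (smul_S b n) _ e)
    · exact V_right (LinearMap.ker φ).subtype φ.rangeRestrict (Submodule.injective_subtype _)
        (LinearMap.surjective_rangeRestrict _) (exact_ker_range φ) (h j hj) (V_tors h2 j)
  | succ k ih =>
    intro L _ _ hL h i hi
    obtain ⟨i, rfl⟩ := Nat.exists_eq_succ_of_ne_zero (Nat.pos_iff_ne_zero.1 (lt_of_le_of_lt (Nat.zero_le _) hi))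
    obtain ⟨F, _, _, φ, h1, h2, h3⟩ := exists_res b L
    have h2' : Tors (a * b) (LinearMap.ker φ) := fun x =>
      (h2 x).imp fun k hk r hr => hk r (Ideal.pow_right_mono Ideal.mul_le_right _ hr)
    refine V_mid (LinearMap.ker φ).subtype φ.rangeRestrict (Submodule.injective_subtype _)
        (LinearMap.surjective_rangeRestrict _) (exact_ker_range φ) (V_tors h2' i) ?_
    have hF : V (S (a * b)) (i + 1) F :=
      V_mul a b (V_of_zero fun n e => h3 _ n (kills_kerSys a b n) _ e) (hA _ (by lia) _ (h1 J hL))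
    refine V_left (LinearMap.range φ).subtype (LinearMap.range φ).mkQ (Submodule.injective_subtype _)
        (Submodule.mkQ_surjective _) (LinearMap.exact_subtype_mkQ _) ?_ hF
    refine ih _ ((h1 J hL).of_surjective _ (Submodule.mkQ_surjective _)) (fun j hj => ?_) i (by lia)
    refine V_right (LinearMap.range φ).subtype (LinearMap.range φ).mkQ (Submodule.injective_subtype _)
        (Submodule.mkQ_surjective _) (LinearMap.exact_subtype_mkQ _)
        (V_of_zero fun n e => h3 _ n (smul_S b n) _ e) ?_
    exact V_right (LinearMap.ker φ).subtype φ.rangeRestrict (Submodule.injective_subtype _)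
        (LinearMap.surjective_rangeRestrict _) (exact_ker_range φ) (h (j + 1) (by lia)) (V_tors h2 _)

theorem V_main [IsNoetherianRing R] (a b : Ideal R) (M : Type) [AddCommGroup M] [Module R M]
    [Module.Finite R M] (c d : ℕ) (ha : ∀ i, c < i → V (S a) i M) (hb : ∀ i, d < i → V (S b) i M) :
    ∀ i, c + d < i → V (S (a * b)) i M :=
  P a b (Module.annihilator R M) c (A_main a M c ha) d M
    (fun r hr x => Module.mem_annihilator.1 hr x) hb

end main

end LC

namespace LC

section interface

variable {R : Type} [CommRing R]

/-- the contravariant Hom functor -/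
noncomputable abbrev HomF (L : ModuleCat.{0} R) : ModuleCat.{0} R ⥤ (ModuleCat.{0} R)ᵒᵖ :=
  ((linearYoneda R (ModuleCat.{0} R)).obj L).rightOp

/-- The Hom complex in the opposite category -/
noncomputable abbrev HomK {X : ModuleCat.{0} R} (P : ProjectiveResolution X) (L : ModuleCat.{0} R) :
    ChainComplex (ModuleCat.{0} R)ᵒᵖ ℕ :=
  ((HomF L).mapHomologicalComplex _).obj P.complex

/-- `f` represents `z` -/
def Rep {X : ModuleCat.{0} R} (P : ProjectiveResolution X) (L : ModuleCat.{0} R) (n : ℕ)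
    (f : P.complex.X n ⟶ L) (z : ((Ext R (ModuleCat.{0} R) n).obj (op X)).obj L) : Prop :=
  ∃ w : ((HomK P L).opcycles n).unop, ((HomK P L).pOpcycles n).unop w = f ∧
    (P.isoLeftDerivedObj (HomF L) n).hom.unop (((HomK P L).homologyι n).unop w) = z

lemma unop_apply {A B C D : (ModuleCat.{0} R)ᵒᵖ} {f : A ⟶ B} {g : B ⟶ C} {f' : A ⟶ D} {g' : D ⟶ C}
    (h : f ≫ g = f' ≫ g') (x : C.unop) : f.unop (g.unop x) = f'.unop (g'.unop x) := by
  have h2 : g.unop ≫ f.unop = g'.unop ≫ f'.unop := by rw [← unop_comp, h, unop_comp]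
  exact congrArg (fun t => t.hom x) h2

lemma Rep_map {X X' : ModuleCat.{0} R} {P : ProjectiveResolution X} {P' : ProjectiveResolution X'}
    {L : ModuleCat.{0} R} {n : ℕ}
    {f : P.complex.X n ⟶ L} {z : ((Ext R (ModuleCat.{0} R) n).obj (op X)).obj L} (h : Rep P L n f z)
    {g : X' ⟶ X} (φ : ProjectiveResolution.Hom P' P g) :
    Rep P' L n (φ.hom.f n ≫ f) ((((Ext R (ModuleCat.{0} R) n).map g.op).app L) z) := by
  obtain ⟨w, rfl, rfl⟩ := h
  let ψ : HomK P' L ⟶ HomK P L := ((HomF L).mapHomologicalComplex _).map φ.hom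
  refine ⟨(HomologicalComplex.opcyclesMap ψ n).unop w, ?_, ?_⟩
  · exact unop_apply (HomologicalComplex.p_opcyclesMap ψ n) w
  · have h1 := unop_apply (HomologicalComplex.homologyι_naturality ψ n) w
    have hc : φ.hom.f 0 ≫ P.π.f 0 = P'.π.f 0 ≫ g := by
      rw [φ.hom_f_zero_comp_π_f_zero]
      rw [ChainComplex.single₀_map_f_zero]
      rfl
    have h2 := unop_apply (ProjectiveResolution.isoLeftDerivedObj_hom_naturality g P' P φ.hom hc
      (HomF L) n) (((HomK P L).homologyι n).unop w)
    refine Eq.trans ?_ h2.symm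
    exact congrArg (fun t => (P'.isoLeftDerivedObj (HomF L) n).hom.unop t) h1.symm

lemma Rep_cocycle {X : ModuleCat.{0} R} {P : ProjectiveResolution X}
    {L : ModuleCat.{0} R} {n : ℕ}
    {f : P.complex.X n ⟶ L} {z : ((Ext R (ModuleCat.{0} R) n).obj (op X)).obj L} (h : Rep P L n f z) :
    P.complex.d (n + 1) n ≫ f = 0 := by
  obtain ⟨w, rfl, rfl⟩ := h
  have h2 : ((HomK P L).pOpcycles n).unop ≫ ((HomK P L).d (n + 1) n).unop = 0 := by
    rw [← unop_comp, HomologicalComplex.d_pOpcycles]; rfl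
  exact congrArg (fun t => t.hom w) h2

lemma Rep_exists {X : ModuleCat.{0} R} {P : ProjectiveResolution X}
    {L : ModuleCat.{0} R} {n : ℕ}
    {f : P.complex.X n ⟶ L} (hf : P.complex.d (n + 1) n ≫ f = 0) : ∃ z, Rep P L n f z := by
  have hex := (ShortComplex.exact_of_g_is_cokernel (ShortComplex.mk _ _
    ((HomK P L).d_pOpcycles (n + 1) n)) ((HomK P L).opcyclesIsCokernel (n + 1) n (by simp))).unop
  rw [ShortComplex.moduleCat_exact_iff] at hex
  obtain ⟨w, hw⟩ := hex f hf
  exact ⟨_, w, hw, rfl⟩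

lemma Rep_exists' {X : ModuleCat.{0} R} (P : ProjectiveResolution X)
    {L : ModuleCat.{0} R} {n : ℕ} (z : ((Ext R (ModuleCat.{0} R) n).obj (op X)).obj L) :
    ∃ f, Rep P L n f z := by
  have h1 : Epi ((HomK P L).homologyι n).unop := inferInstance
  rw [ModuleCat.epi_iff_surjective] at h1
  have h2 : Epi (P.isoLeftDerivedObj (HomF L) n).hom.unop := inferInstance
  rw [ModuleCat.epi_iff_surjective] at h2
  obtain ⟨y, rfl⟩ := h2 z
  obtain ⟨w, rfl⟩ := h1 y
  exact ⟨_, w, rfl, rfl⟩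

lemma Rep_zero_iff {X : ModuleCat.{0} R} {P : ProjectiveResolution X}
    {L : ModuleCat.{0} R} {n : ℕ}
    {f : P.complex.X (n + 1) ⟶ L} {z : ((Ext R (ModuleCat.{0} R) (n + 1)).obj (op X)).obj L}
    (h : Rep P L (n + 1) f z) :
    z = 0 ↔ ∃ g : P.complex.X n ⟶ L, P.complex.d (n + 1) n ≫ g = f := by
  obtain ⟨w, rfl, rfl⟩ := h
  have h2 : Mono (P.isoLeftDerivedObj (HomF L) (n + 1)).hom.unop := inferInstance
  rw [ModuleCat.mono_iff_injective] at h2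
  have h3 : Mono ((HomK P L).pOpcycles (n + 1)).unop := inferInstance
  rw [ModuleCat.mono_iff_injective] at h3
  have h4 : ∀ g : P.complex.X n ⟶ L, ((HomK P L).pOpcycles (n + 1)).unop
      (((HomK P L).fromOpcycles (n + 1) n).unop g) = P.complex.d (n + 1) n ≫ g := by
    intro g
    have : ((HomK P L).fromOpcycles (n + 1) n).unop ≫ ((HomK P L).pOpcycles (n + 1)).unop
      = ((HomK P L).d (n + 1) n).unop := by
      rw [← unop_comp, HomologicalComplex.p_fromOpcycles]
    exact congrArg (fun t => t.hom g) this
  have hex := (ShortComplex.exact_of_f_is_kernel (ShortComplex.mk _ _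
    ((HomK P L).homologyι_comp_fromOpcycles (n + 1) n))
    ((HomK P L).homologyIsKernel (n + 1) n (by simp))).unop
  constructor
  · intro h
    have h5 : ((HomK P L).homologyι (n + 1)).unop w = 0 := h2 (h.trans (map_zero _).symm)
    rw [ShortComplex.moduleCat_exact_iff] at hex
    obtain ⟨g, hg⟩ := hex w h5
    refine ⟨g, ?_⟩
    exact (h4 g).symm.trans (congrArg (fun t => ((HomK P L).pOpcycles (n + 1)).unop t) hg)
  · rintro ⟨g, hg⟩
    rw [← h4] at hg
    have hg' := h3 hg
    have h6 : ((HomK P L).fromOpcycles (n + 1) n).unop ≫ ((HomK P L).homologyι (n + 1)).unop = 0 := by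
      rw [← unop_comp, HomologicalComplex.homologyι_comp_fromOpcycles]; rfl
    have h7 : ((HomK P L).homologyι (n + 1)).unop w = 0 := by
      rw [← hg']
      exact congrArg (fun t => t.hom g) h6
    refine Eq.trans ?_ (map_zero (P.isoLeftDerivedObj (HomF L) (n + 1)).hom.unop.hom)
    exact congrArg (fun t => (P.isoLeftDerivedObj (HomF L) (n + 1)).hom.unop t) h7

/-- the relation between the two versions of Ext -/
def Rel {X L : ModuleCat.{0} R} {n : ℕ} (e : E X L n)
    (z : ((Ext R (ModuleCat.{0} R) n).obj (op X)).obj L) : Prop :=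
  ∃ (f : (projectiveResolution X).complex.X n ⟶ L)
    (hf : (projectiveResolution X).complex.d (n + 1) n ≫ f = 0),
    Rep (projectiveResolution X) L n f z ∧ (projectiveResolution X).extMk f (n + 1) rfl hf = e

lemma Rel_left {X L : ModuleCat.{0} R} {n : ℕ} (e : E X L n) :
    ∃ z : ((Ext R (ModuleCat.{0} R) n).obj (op X)).obj L, Rel e z := by
  obtain ⟨f, hf, rfl⟩ := (projectiveResolution X).extMk_surjective e (n + 1) rfl
  obtain ⟨z, hz⟩ := Rep_exists hf
  exact ⟨z, f, hf, hz, rfl⟩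

lemma Rel_right {X L : ModuleCat.{0} R} {n : ℕ}
    (z : ((Ext R (ModuleCat.{0} R) n).obj (op X)).obj L) : ∃ e : E X L n, Rel e z := by
  obtain ⟨f, hf⟩ := Rep_exists' (projectiveResolution X) z
  exact ⟨_, f, Rep_cocycle hf, hf, rfl⟩

lemma Rel_zero {X L : ModuleCat.{0} R} {n : ℕ} {e : E X L (n + 1)}
    {z : ((Ext R (ModuleCat.{0} R) (n + 1)).obj (op X)).obj L} (h : Rel e z) : z = 0 ↔ e = 0 := by
  obtain ⟨f, hf, hz, rfl⟩ := h
  rw [Rep_zero_iff hz, ProjectiveResolution.extMk_eq_zero_iff _ _ _ _ _ n rfl]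

lemma Rel_map {X X' L : ModuleCat.{0} R} {n : ℕ} {e : E X L n}
    {z : ((Ext R (ModuleCat.{0} R) n).obj (op X)).obj L} (h : Rel e z) (g : X' ⟶ X) :
    Rel (pre g e) ((((Ext R (ModuleCat.{0} R) n).map g.op).app L) z) := by
  obtain ⟨f, hf, hz, rfl⟩ := h
  let φ : ProjectiveResolution.Hom (projectiveResolution X') (projectiveResolution X) g :=
    { hom := ProjectiveResolution.lift g _ _
      hom_f_zero_comp_π_f_zero := by
        rw [ChainComplex.single₀_map_f_zero]
        exact ProjectiveResolution.lift_commutes_zero g _ _ }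
  have h1 := Rep_map hz φ
  exact ⟨_, Rep_cocycle h1, h1, (ProjectiveResolution.mk₀_comp_extMk f (n + 1) rfl hf φ).symm⟩

end interface

end LC

namespace LC

section final

open Limits

variable {R : Type} [CommRing R]

/-- the evaluated diagram -/
noncomputable abbrev DG (a : Ideal R) (i : ℕ) (M : ModuleCat.{0} R) : (ℕᵒᵖ)ᵒᵖ ⥤ ModuleCat.{0} R :=
  localCohomology.diagram (localCohomology.idealPowersDiagram a) i ⋙ (evaluation _ _).obj M

lemma subsingleton_iff_colimit (a : Ideal R) (i : ℕ) (M : ModuleCat.{0} R) :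
    Subsingleton ((localCohomology a i).obj M) ↔ Subsingleton (colimit (DG a i M) : ModuleCat.{0} R) := by
  have I : (localCohomology a i).obj M ≅ colimit (DG a i M) :=
    colimitObjIsoColimitCompEvaluation
      (localCohomology.diagram (localCohomology.idealPowersDiagram a) i) M
  exact I.toLinearEquiv.toEquiv.subsingleton_congr

lemma subsingleton_iff_V (a : Ideal R) (i : ℕ) (M : ModuleCat.{0} R) :
    Subsingleton ((localCohomology a (i + 1)).obj M) ↔ V (S a) (i + 1) M := by
  rw [subsingleton_iff_colimit]
  constructor
  · intro h n e
    obtain ⟨z, hz⟩ := Rel_left e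
    obtain ⟨j, f, hf⟩ := Concrete.colimit_rep_eq_zero (R := R) (DG a (i + 1) M)
      (j := op (op n)) z (Subsingleton.elim _ _)
    refine ⟨j.unop.unop, leOfHom f.unop.unop, ?_⟩
    exact (Rel_zero (Rel_map hz _)).1 hf
  · intro h
    refine subsingleton_of_forall_eq 0 fun x => ?_
    obtain ⟨j, z, rfl⟩ := Concrete.colimit_exists_rep (DG a (i + 1) M) x
    obtain ⟨e, he⟩ := Rel_right (R := R) (L := M) z
    obtain ⟨m, hm, h0⟩ := h j.unop.unop e
    have h1 := (Rel_zero (Rel_map he ((S a).map (homOfLE hm).op))).2 h0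
    let f : j ⟶ op (op m) := (homOfLE hm).op.op
    have h2 := ConcreteCategory.congr_hom (colimit.w (DG a (i + 1) M) f) z
    refine h2.symm.trans ?_
    refine Eq.trans ?_ (map_zero (colimit.ι (DG a (i + 1) M) (op (op m))).hom)
    exact congrArg (fun t => colimit.ι (DG a (i + 1) M) (op (op m)) t) h1

lemma cohDim_spec [IsNoetherianRing R] (a : Ideal R) (M : ModuleCat.{0} R) (i : ℕ)
    (hi : cohDim a M < i) : V (S a) i M := by
  obtain ⟨N, hN⟩ := exists_bound a
  have hb : BddAbove {i : ℕ | Nontrivial ((localCohomology a i).obj M)} := by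
    refine ⟨N, fun j hj => ?_⟩
    by_contra hlt
    obtain ⟨k, rfl⟩ : ∃ k, j = k + 1 := ⟨j - 1, by omega⟩
    have := (subsingleton_iff_V a k M).2 (hN (k + 1) (by omega) M)
    exact not_subsingleton_iff_nontrivial.2 hj this
  obtain ⟨k, rfl⟩ : ∃ k, i = k + 1 := ⟨i - 1, by omega⟩
  rw [← subsingleton_iff_V, ← not_nontrivial_iff_subsingleton]
  intro h
  have := le_csSup hb h
  exact absurd hi (not_lt.2 this)

lemma main [IsNoetherianRing R] (a b : Ideal R)
    (M : ModuleCat.{0} R) [Module.Finite R M] :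
    cohDim (a ⊓ b) M ≤ cohDim a M + cohDim b M := by
  refine csSup_le' fun i hi => ?_
  by_contra hlt
  obtain ⟨k, rfl⟩ : ∃ k, i = k + 1 := ⟨i - 1, by omega⟩
  have h := V_main a b M _ _ (cohDim_spec a M) (cohDim_spec b M) (k + 1) (by omega)
  have h2 := (subsingleton_iff_V (a * b) k M).2 h
  have hr : (a ⊓ b).radical = (a * b).radical := by
    rw [Ideal.radical_inf, Ideal.radical_mul]
  have I := (localCohomology.isoOfSameRadical hr (k + 1)).app M
  have h3 := I.toLinearEquiv.toEquiv.subsingleton_congr.2 h2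
  exact not_subsingleton_iff_nontrivial.2 hi h3

end final

end LC

theorem statement2 {R : Type} [CommRing R] [IsNoetherianRing R] (a b : Ideal R)
    (M : ModuleCat R) [Module.Finite R M] :
    cohDim (a ⊓ b) M ≤ cohDim a M + cohDim b M := by
  exact LC.main a b M
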